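/- Let n ≥ 2, let J be the (n+1)×(n+1) diagonal matrix diag(1,−1,…,−1), let G = SO(1,n) = {g ∈ SL(n+1,ℝ) : gᵀ J g = J}, and let Γ = G ∩ SL(n+1,ℤ) be the subgroup of elements of G with integer entries. Let a : ℝ → G be a continuous one-parameter subgroup such that each a(t) is diagonalizable over ℝ, and let g ∈ G. Then the orbit t ↦ a(t)g·(eΓ) in G/Γ tends to the cocompact filter as t → +∞ (diverges to infinity) if and only if there exist an integer ℓ ≥ 1, a continuous group homomorphism ρ : G → SL(ℓ,ℝ) with ρ(Γ) contained in the image of SL(ℓ,ℤ), and a nonzero vector v ∈ ℤ^ℓ, such that ρ(a(t)g)·v → 0 in ℝ^ℓ as t → +∞. -/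

import Mathlib

open Matrix MatrixGroups Filter Topology

noncomputable instance {n : ℕ} : TopologicalSpace (Matrix.SpecialLinearGroup (Fin n) ℝ) :=
  instTopologicalSpaceSubtype

/-- The image of `SL(ℓ,ℤ)` in `SL(ℓ,ℝ)`. -/
def SLZ (ℓ : ℕ) : Subgroup (SL(ℓ, ℝ)) :=
  (Matrix.SpecialLinearGroup.map (n := Fin ℓ) (Int.castRingHom ℝ)).range

/-- The matrix `J = diag(1, -1, …, -1)` of the quadratic form `x₀² - x₁² - ⋯ - xₙ²`. -/
def Jmat (n : ℕ) : Matrix (Fin (n + 1)) (Fin (n + 1)) ℝ :=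
  Matrix.diagonal fun i => if i = 0 then (1 : ℝ) else -1

/-- `SO(1,n)`, the subgroup of `SL(n+1,ℝ)` preserving `x₀² - x₁² - ⋯ - xₙ²`. -/
def SO1n (n : ℕ) : Subgroup (SL(n + 1, ℝ)) where
  carrier := {g | (g : Matrix (Fin (n + 1)) (Fin (n + 1)) ℝ)ᵀ * Jmat n * g = Jmat n}
  one_mem' := by simp
  mul_mem' := by
    intro a b ha hb
    simp only [Set.mem_setOf_eq] at ha hb ⊢
    have hab : ((a * b : SL(n + 1, ℝ)) : Matrix (Fin (n + 1)) (Fin (n + 1)) ℝ) =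
        (a : Matrix (Fin (n + 1)) (Fin (n + 1)) ℝ) * b := rfl
    rw [hab, Matrix.transpose_mul,
      show ((b : Matrix (Fin (n + 1)) (Fin (n + 1)) ℝ)ᵀ *
          (a : Matrix (Fin (n + 1)) (Fin (n + 1)) ℝ)ᵀ * Jmat n *
          ((a : Matrix (Fin (n + 1)) (Fin (n + 1)) ℝ) * b)) =
        (b : Matrix (Fin (n + 1)) (Fin (n + 1)) ℝ)ᵀ *
          ((a : Matrix (Fin (n + 1)) (Fin (n + 1)) ℝ)ᵀ * Jmat n * a) * b from by
        noncomm_ring, ha, hb]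
  inv_mem' := by
    intro g hg
    simp only [Set.mem_setOf_eq] at hg ⊢
    have hgg : (g : Matrix (Fin (n + 1)) (Fin (n + 1)) ℝ) * (g⁻¹ : SL(n + 1, ℝ)) = 1 := by
      rw [← Matrix.SpecialLinearGroup.coe_mul, mul_inv_cancel,
        Matrix.SpecialLinearGroup.coe_one]
    have key : ((g⁻¹ : SL(n + 1, ℝ)) : Matrix (Fin (n + 1)) (Fin (n + 1)) ℝ)ᵀ *
        ((g : Matrix (Fin (n + 1)) (Fin (n + 1)) ℝ)ᵀ * Jmat n * g) *
        ((g⁻¹ : SL(n + 1, ℝ)) : Matrix (Fin (n + 1)) (Fin (n + 1)) ℝ) =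
        ((g : Matrix (Fin (n + 1)) (Fin (n + 1)) ℝ) *
            ((g⁻¹ : SL(n + 1, ℝ)) : Matrix (Fin (n + 1)) (Fin (n + 1)) ℝ))ᵀ * Jmat n *
          ((g : Matrix (Fin (n + 1)) (Fin (n + 1)) ℝ) *
            ((g⁻¹ : SL(n + 1, ℝ)) : Matrix (Fin (n + 1)) (Fin (n + 1)) ℝ)) := by
      rw [Matrix.transpose_mul]
      noncomm_ring
    rw [hg, hgg] at key
    simpa using key

/-- `Γ = SO(1,n) ∩ SL(n+1,ℤ)`. -/
def SO1nZ (n : ℕ) : Subgroup (SO1n n) :=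
  Subgroup.comap (SO1n n).subtype (SLZ (n + 1))


theorem dn_minkowski (m : ℕ) (A : Matrix (Fin m) (Fin m) ℝ) (h0 : A.det ≠ 0)
    (h1 : |A.det| < 1) :
    ∃ v : Fin m → ℤ, v ≠ 0 ∧ ∀ i, |(A *ᵥ (fun j => (v j : ℝ))) i| ≤ 1 := by
  classical
  let b := Pi.basisFun ℝ (Fin m)
  let s : Set (Fin m → ℝ) := (Matrix.toLin' A) ⁻¹' (Set.Icc (fun _ => -1) (fun _ => 1))
  have hdet : LinearMap.det (Matrix.toLin' A) = A.det := LinearMap.det_toLin' A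
  have hvol : MeasureTheory.volume s = ENNReal.ofReal |A.det⁻¹| * 2 ^ m := by
    rw [MeasureTheory.Measure.addHaar_preimage_linearMap _ (by rwa [hdet]), hdet,
      Real.volume_Icc_pi]
    norm_num
  have hF : MeasureTheory.volume (ZSpan.fundamentalDomain b) = 1 := by
    rw [ZSpan.fundamentalDomain_pi_basisFun]
    rw [Real.volume_pi_Ico]
    simp
  have hb := ZSpan.isAddFundamentalDomain' b MeasureTheory.volume
  have : Countable (Submodule.span ℤ (Set.range b)).toAddSubgroup := by
    change Countable (Submodule.span ℤ (Set.range b))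
    infer_instance
  obtain ⟨x, hx0, hx⟩ := MeasureTheory.exists_ne_zero_mem_lattice_of_measure_mul_two_pow_lt_measure
    hb (s := s) (by
      intro x hx
      simp only [s, Set.mem_preimage, Set.mem_Icc, Pi.le_def, map_neg, Pi.neg_apply] at hx ⊢
      exact ⟨fun i => by linarith [hx.2 i], fun i => by linarith [hx.1 i]⟩)
    ((convex_Icc _ _).linear_preimage _) (by
      rw [hF, hvol]
      simp only [Module.finrank_fin_fun]
      refine ENNReal.mul_lt_mul_left (by simp) (by simp) ?_
      rw [← ENNReal.ofReal_one]
      rw [ENNReal.ofReal_lt_ofReal_iff_of_nonneg zero_le_one, abs_inv]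
      exact (one_lt_inv₀ (abs_pos.2 h0)).2 h1)
  have hmem : (x : Fin m → ℝ) ∈ Submodule.span ℤ (Set.range b) := x.2
  rw [Module.Basis.mem_span_iff_repr_mem] at hmem
  choose v hv using hmem
  have hv' : (fun j => (v j : ℝ)) = (x : Fin m → ℝ) := by
    ext j
    have := hv j
    simpa [b] using this
  refine ⟨v, ?_, ?_⟩
  · rintro rfl
    apply hx0
    ext j
    rw [← hv']; simp
  · intro i
    rw [hv']
    simp only [s, Set.mem_preimage, Set.mem_Icc, Pi.le_def, Matrix.toLin'_apply] at hx
    exact abs_le.2 ⟨hx.1 i, hx.2 i⟩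

theorem dn_iso (n : ℕ) (x y : Fin (n+1) → ℤ)
    (hxx : x 0 * x 0 - ∑ i : Fin n, x i.succ * x i.succ = 0)
    (hyy : y 0 * y 0 - ∑ i : Fin n, y i.succ * y i.succ = 0)
    (hxy : x 0 * y 0 - ∑ i : Fin n, x i.succ * y i.succ = 0) (hx : x ≠ 0) :
    x 0 ≠ 0 ∧ ∀ i, y 0 * x i = x 0 * y i := by
  constructor
  · intro h
    apply hx
    have h2 : ∑ i : Fin n, x i.succ * x i.succ = 0 := by rw [h] at hxx; linarith
    rw [Finset.sum_eq_zero_iff_of_nonneg (fun i _ => mul_self_nonneg _)] at h2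
    ext i
    refine Fin.cases h (fun i => ?_) i
    simpa using h2 i (Finset.mem_univ _)
  · have h3 : ∑ i : Fin n, (y 0 * x i.succ - x 0 * y i.succ) * (y 0 * x i.succ - x 0 * y i.succ) = 0 := by
      have : ∀ i : Fin n, (y 0 * x i.succ - x 0 * y i.succ) * (y 0 * x i.succ - x 0 * y i.succ)
        = (y 0)^2 * (x i.succ * x i.succ) + (x 0)^2 * (y i.succ * y i.succ)
          - (2 * x 0 * y 0) * (x i.succ * y i.succ) := fun i => by ring
      simp only [this, Finset.sum_sub_distrib, Finset.sum_add_distrib, ← Finset.mul_sum]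
      rw [← sub_eq_zero.1 hxx, ← sub_eq_zero.1 hyy, ← sub_eq_zero.1 hxy]; ring
    rw [Finset.sum_eq_zero_iff_of_nonneg (fun i _ => mul_self_nonneg _)] at h3
    intro i
    refine Fin.cases (by ring) (fun i => ?_) i
    have := h3 i (Finset.mem_univ _)
    have := mul_self_eq_zero.1 this
    linarith

theorem dn_B (n : ℕ) (x y : Fin (n+1) → ℝ) :
    x ⬝ᵥ (Jmat n *ᵥ y) = x 0 * y 0 - ∑ i : Fin n, x i.succ * y i.succ := by
  simp [Jmat, dotProduct, Matrix.mulVec_diagonal, Fin.sum_univ_succ, sub_eq_add_neg]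

theorem dn_inv (n : ℕ) (g : SO1n n) (x y : Fin (n+1) → ℝ) :
    (((g : SL(n+1, ℝ)) : Matrix (Fin (n+1)) (Fin (n+1)) ℝ) *ᵥ x) ⬝ᵥ (Jmat n *ᵥ
      (((g : SL(n+1, ℝ)) : Matrix (Fin (n+1)) (Fin (n+1)) ℝ) *ᵥ y)) = x ⬝ᵥ (Jmat n *ᵥ y) := by
  have h : ((g : SL(n+1, ℝ)) : Matrix (Fin (n+1)) (Fin (n+1)) ℝ)ᵀ * Jmat n *
    ((g : SL(n+1, ℝ)) : Matrix (Fin (n+1)) (Fin (n+1)) ℝ) = Jmat n := g.2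
  conv_rhs => rw [← h]
  rw [Matrix.mulVec_mulVec, Matrix.mul_assoc, ← Matrix.mulVec_mulVec _ _ᵀ, Matrix.dotProduct_mulVec x,
    Matrix.vecMul_transpose]

theorem dn_Bsmall (n : ℕ) (ε : ℝ) (hε : 0 < ε) (hε1 : (n + 1) * (ε * ε) ≤ 1) (g : SO1n n)
    (v w : Fin (n+1) → ℤ)
    (hv : ∀ i, |(((g : SL(n+1, ℝ)) : Matrix (Fin (n+1)) (Fin (n+1)) ℝ) *ᵥ
      (fun j => (v j : ℝ))) i| < ε)
    (hw : ∀ i, |(((g : SL(n+1, ℝ)) : Matrix (Fin (n+1)) (Fin (n+1)) ℝ) *ᵥ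
      (fun j => (w j : ℝ))) i| < ε) :
    v 0 * w 0 - ∑ i : Fin n, v i.succ * w i.succ = 0 := by
  have h1 := dn_inv n g (fun j => (v j : ℝ)) (fun j => (w j : ℝ))
  rw [dn_B, dn_B] at h1
  set p := ((g : SL(n+1, ℝ)) : Matrix (Fin (n+1)) (Fin (n+1)) ℝ) *ᵥ (fun j => (v j : ℝ))
  set q := ((g : SL(n+1, ℝ)) : Matrix (Fin (n+1)) (Fin (n+1)) ℝ) *ᵥ (fun j => (w j : ℝ))
  have hpq : ∀ i, |p i * q i| < ε * ε := fun i => by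
    rw [abs_mul]
    exact mul_lt_mul'' (hv i) (hw i) (abs_nonneg _) (abs_nonneg _)
  have h2 : |p 0 * q 0 - ∑ i : Fin n, p i.succ * q i.succ| < 1 := by
    calc _ ≤ |p 0 * q 0| + |∑ i : Fin n, p i.succ * q i.succ| := abs_sub _ _
      _ ≤ |p 0 * q 0| + ∑ i : Fin n, |p i.succ * q i.succ| := by
        gcongr; exact Finset.abs_sum_le_sum_abs _ _
      _ < ε * ε + ∑ i : Fin n, ε * ε :=
        add_lt_add_of_lt_of_le (hpq 0) (Finset.sum_le_sum fun i _ => (hpq _).le)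
      _ = (n + 1) * (ε * ε) := by simp; ring
      _ ≤ 1 := hε1
  rw [h1] at h2
  rw [← Int.abs_lt_one_iff]
  exact_mod_cast h2

theorem dn_reduce (m : ℕ) (ε : ℝ) (hε : 0 < ε) : ∃ C : ℝ, ∀ g : Matrix (Fin m) (Fin m) ℝ,
    g.det = 1 →
    (∀ v : Fin m → ℤ, v ≠ 0 → ∃ i, ε ≤ |(g *ᵥ (fun j => (v j : ℝ))) i|) →
    ∃ V : Matrix (Fin m) (Fin m) ℤ, V.det ≠ 0 ∧
      ∀ i j, |(g * V.map (Int.cast : ℤ → ℝ)) i j| ≤ C := by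
  classical
  obtain ⟨δ, hδ, hδε⟩ : ∃ δ : ℝ, 0 < δ ∧ δ < ε := ⟨ε / 2, by linarith, by linarith⟩
  obtain ⟨s, hs, hsδ⟩ : ∃ s : ℝ, 0 < s ∧ δ⁻¹ ^ m * s = 1 / 2 :=
    ⟨δ ^ m / 2, by positivity, by
      rw [inv_pow]; field_simp⟩
  refine ⟨δ + |s - 1| * (δ * m / s), fun g hg hgv => ?_⟩
  set C := δ + |s - 1| * (δ * m / s) with hC
  let X : Set (Fin m → ℝ) := {x | ∃ v : Fin m → ℤ, x = g *ᵥ (fun j => (v j : ℝ)) ∧ ∀ i, |x i| ≤ C}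
  have hspan : Submodule.span ℝ X = ⊤ := by
    by_contra hne
    obtain ⟨f, hf0, hf⟩ := Submodule.exists_le_ker_of_lt_top _ (lt_top_iff_ne_top.2 hne)
    obtain ⟨u, hu1, huX⟩ : ∃ u : Fin m → ℝ, u ⬝ᵥ u = 1 ∧ ∀ x ∈ X, u ⬝ᵥ x = 0 := by
      let w : Fin m → ℝ := fun i => f (Pi.single i 1)
      have hw : ∀ x, w ⬝ᵥ x = f x := fun x => by
        conv_rhs => rw [pi_eq_sum_univ' x]
        simp [w, dotProduct, mul_comm]
      have hw0 : w ≠ 0 := by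
        intro h
        apply hf0
        ext i
        exact congrFun h i
      have hww : 0 < w ⬝ᵥ w := by
        refine lt_of_le_of_ne (Finset.sum_nonneg fun i _ => mul_self_nonneg _) ?_
        intro h
        exact hw0 (dotProduct_self_eq_zero.1 h.symm)
      refine ⟨(√(w ⬝ᵥ w))⁻¹ • w, ?_, ?_⟩
      · simp only [smul_dotProduct, dotProduct_smul, smul_eq_mul]
        have := Real.mul_self_sqrt hww.le
        have h2 := Real.sqrt_pos.2 hww
        field_simp
        linarith
      · intro x hx
        have : f x = 0 := hf (Submodule.subset_span hx)
        rw [smul_dotProduct, hw x, this, smul_zero]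
    have hu : ∀ i, |u i| ≤ 1 := by
      intro i
      rw [abs_le_one_iff_mul_self_le_one, ← hu1]
      exact Finset.single_le_sum (f := fun i => u i * u i)
        (fun i _ => mul_self_nonneg _) (Finset.mem_univ i)
    let M : Matrix (Fin m) (Fin m) ℝ := 1 + replicateCol Unit ((s - 1) • u) * replicateRow Unit u
    have hM : M.det = s := by
      simp only [M]
      rw [det_one_add_replicateCol_mul_replicateRow, dotProduct_smul, hu1]
      simp
    have hMx : ∀ x, M *ᵥ x = x + ((s - 1) * (u ⬝ᵥ x)) • u := by
      intro x
      ext i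
      simp only [M]
      rw [add_mulVec, one_mulVec, Pi.add_apply, Pi.add_apply]
      congr 1
      simp only [mulVec, dotProduct, Matrix.mul_apply, replicateCol_apply, replicateRow_apply,
        Finset.univ_unique, Finset.sum_singleton, Pi.smul_apply, smul_eq_mul, Finset.mul_sum,
        Finset.sum_mul]
      exact Finset.sum_congr rfl fun j _ => by ring
    have hA : (δ⁻¹ • M * g).det = 1 / 2 := by
      rw [det_mul, hg, det_smul, hM, mul_one, Fintype.card_fin, hsδ]
    obtain ⟨v, hv0, hv⟩ := dn_minkowski m (δ⁻¹ • M * g) (by rw [hA]; norm_num)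
      (by rw [hA, abs_of_pos] <;> norm_num)
    set x := g *ᵥ (fun j => (v j : ℝ)) with hx
    set y := (δ⁻¹ • M * g) *ᵥ (fun j => (v j : ℝ)) with hy
    have hyx : y = δ⁻¹ • (x + ((s - 1) * (u ⬝ᵥ x)) • u) := by
      rw [hy, ← mulVec_mulVec, smul_mulVec, hMx]
    have hxy : ∀ i, x i = δ * y i - (s - 1) * (u ⬝ᵥ x) * u i := by
      intro i
      rw [hyx]
      simp
      field_simp
      ring
    have huy : u ⬝ᵥ y = δ⁻¹ * s * (u ⬝ᵥ x) := by
      rw [hyx, dotProduct_smul, dotProduct_add, dotProduct_smul, hu1]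
      simp; ring
    have huy1 : |u ⬝ᵥ y| ≤ m := by
      calc |u ⬝ᵥ y| ≤ ∑ i, |u i * y i| := Finset.abs_sum_le_sum_abs _ _
        _ ≤ ∑ i : Fin m, 1 := Finset.sum_le_sum fun i _ => by
            rw [abs_mul]; exact mul_le_one₀ (hu i) (abs_nonneg _) (hv i)
        _ = m := by simp
    have hux : |u ⬝ᵥ x| ≤ δ * m / s := by
      have : u ⬝ᵥ x = δ / s * (u ⬝ᵥ y) := by rw [huy]; field_simp
      rw [this, abs_mul, abs_of_pos (by positivity : 0 < δ / s)]
      calc δ / s * |u ⬝ᵥ y| ≤ δ / s * m := by gcongr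
        _ = _ := by ring
    have hxC : ∀ i, |x i| ≤ C := by
      intro i
      rw [hxy i]
      calc _ ≤ |δ * y i| + |(s - 1) * (u ⬝ᵥ x) * u i| := abs_sub _ _
        _ = δ * |y i| + |s - 1| * |u ⬝ᵥ x| * |u i| := by
          rw [abs_mul, abs_mul, abs_mul, abs_of_pos hδ]
        _ ≤ δ * 1 + |s - 1| * (δ * m / s) * 1 := by
          gcongr
          · exact hv i
          · exact hu i
        _ = C := by rw [hC]; ring
    have h0 := huX x ⟨v, rfl, hxC⟩
    obtain ⟨i, hi⟩ := hgv v hv0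
    have h3 := hxy i
    rw [h0] at h3
    rw [← hx, h3] at hi
    simp only [mul_zero, zero_mul, sub_zero, abs_mul, abs_of_pos hδ] at hi
    have := hv i
    nlinarith
  obtain ⟨b, hbX, hbs, hbl⟩ := exists_linearIndependent ℝ X
  let B := Module.Basis.mk hbl (by rw [Subtype.range_coe, hbs, hspan])
  let e := (Pi.basisFun ℝ (Fin m)).indexEquiv B
  have he : ∀ j, ∃ v : Fin m → ℤ, ((e j : b) : Fin m → ℝ) = g *ᵥ (fun k => (v k : ℝ)) ∧
    ∀ i, |((e j : b) : Fin m → ℝ) i| ≤ C := fun j => hbX (e j).2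
  choose v hv hvC using he
  let V : Matrix (Fin m) (Fin m) ℤ := Matrix.of fun i j => v j i
  have hgV : ∀ i j, (g * V.map (Int.cast : ℤ → ℝ)) i j = ((e j : b) : Fin m → ℝ) i := by
    intro i j
    rw [hv j]
    rfl
  refine ⟨V, ?_, fun i j => by rw [hgV]; exact hvC j i⟩
  have hli : LinearIndependent ℝ (g * V.map (Int.cast : ℤ → ℝ)).col := by
    have : (g * V.map (Int.cast : ℤ → ℝ)).col = (Subtype.val : b → _) ∘ e := by
      ext j i
      exact hgV i j
    rw [this]
    exact hbl.comp _ e.injective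
  rw [linearIndependent_cols_iff_isUnit, isUnit_iff_isUnit_det, det_mul, hg, one_mul] at hli
  intro h
  have h2 : (V.map (Int.cast : ℤ → ℝ)).det = 0 := by
    have := (Int.castRingHom ℝ).map_det V
    rw [h] at this
    simpa using this.symm
  rw [h2] at hli
  exact not_isUnit_zero hli

def dnJZ (n : ℕ) : Matrix (Fin (n + 1)) (Fin (n + 1)) ℤ :=
  Matrix.diagonal fun i => if i = 0 then 1 else -1

theorem dn_JZ (n : ℕ) : (dnJZ n).map (Int.cast : ℤ → ℝ) = Jmat n := by
  unfold dnJZ Jmat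
  rw [Matrix.diagonal_map (by simp)]
  congr 1
  ext i
  by_cases h : i = 0 <;> simp [h]

theorem dn_cast_mul {m : ℕ} (A B : Matrix (Fin m) (Fin m) ℤ) :
    (A * B).map (Int.cast : ℤ → ℝ) = A.map (Int.cast : ℤ → ℝ) * B.map (Int.cast : ℤ → ℝ) :=
  Matrix.map_mul (f := Int.castRingHom ℝ)

theorem dn_cast_det {m : ℕ} (A : Matrix (Fin m) (Fin m) ℤ) :
    (A.map (Int.cast : ℤ → ℝ)).det = (A.det : ℝ) :=
  ((Int.castRingHom ℝ).map_det A).symm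

def dnι (n : ℕ) (x : SO1n n) : Matrix (Fin (n + 1)) (Fin (n + 1)) ℝ :=
  ((x : SL(n + 1, ℝ)) : Matrix (Fin (n + 1)) (Fin (n + 1)) ℝ)

theorem dn_emb (n : ℕ) : IsClosedEmbedding (dnι n) := by
  have h1 : IsClosedEmbedding
      (fun x : SL(n + 1, ℝ) => (x : Matrix (Fin (n + 1)) (Fin (n + 1)) ℝ)) := by
    have : IsClosed {A : Matrix (Fin (n + 1)) (Fin (n + 1)) ℝ | A.det = 1} :=
      isClosed_eq (continuous_id.matrix_det) continuous_const
    exact this.isClosedEmbedding_subtypeVal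
  have h2 : IsClosed ((SO1n n : Subgroup (SL(n + 1, ℝ))) : Set (SL(n + 1, ℝ))) := by
    have hc := h1.continuous
    change IsClosed {g : SL(n + 1, ℝ) |
      (g : Matrix (Fin (n + 1)) (Fin (n + 1)) ℝ)ᵀ * Jmat n * g = Jmat n}
    exact isClosed_eq ((hc.matrix_transpose.matrix_mul continuous_const).matrix_mul hc)
      continuous_const
  exact h1.comp h2.isClosedEmbedding_subtypeVal

def dnbox (m : ℕ) (C : ℝ) : Set (Matrix (Fin m) (Fin m) ℝ) :=
  {X | ∀ i j, |X i j| ≤ C}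

theorem dn_box (m : ℕ) (C : ℝ) : IsCompact (dnbox m C) := by
  have : dnbox m C = Set.pi Set.univ fun _ => Set.pi Set.univ fun _ => Set.Icc (-C) C := by
    ext X
    constructor
    · intro h i _ j _
      exact abs_le.1 (h i j)
    · intro h i j
      exact abs_le.2 (h i trivial j trivial)
  rw [this]
  exact isCompact_univ_pi fun _ => isCompact_univ_pi fun _ => isCompact_Icc

def dnkey (n : ℕ) (V : Matrix (Fin (n + 1)) (Fin (n + 1)) ℤ) :
    (Fin (n + 1) → Fin (n + 1) → ℤ) × ℤ × (Fin (n + 1) → Fin (n + 1) → ℤ) :=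
  (fun i j => (Vᵀ * dnJZ n * V) i j, V.det, fun i j => V i j % V.det)

theorem dn_key_finite (n : ℕ) (C : ℝ) :
    (dnkey n '' {V | V.det ≠ 0 ∧ ∃ g : SO1n n,
      dnι n g * V.map (Int.cast : ℤ → ℝ) ∈ dnbox (n + 1) C}).Finite := by
  classical
  have hb : ∀ F : Matrix (Fin (n + 1)) (Fin (n + 1)) ℝ → ℝ, Continuous F →
      ∃ B : ℝ, ∀ X ∈ dnbox (n + 1) C, |F X| ≤ B := fun F hF =>
    (dn_box (n + 1) C).exists_bound_of_continuousOn hF.continuousOn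
  obtain ⟨D, hD⟩ := hb (fun X => X.det) continuous_id.matrix_det
  have hE := fun i j => hb (fun X => (Xᵀ * Jmat n * X) i j)
    (((continuous_id.matrix_transpose.matrix_mul continuous_const).matrix_mul
      continuous_id).matrix_elem i j)
  choose E hE using hE
  refine (Set.finite_Icc ((fun i j => ⌈-E i j⌉, ⌈-D⌉, fun _ _ => 0) :
    (Fin (n + 1) → Fin (n + 1) → ℤ) × ℤ × (Fin (n + 1) → Fin (n + 1) → ℤ))
    (fun i j => ⌊E i j⌋, ⌊D⌋, fun _ _ => ⌊D⌋)).subset ?_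
  rintro _ ⟨V, ⟨hV0, g, hg⟩, rfl⟩
  have hdet : |(V.det : ℝ)| ≤ D := by
    have := hD _ hg
    have h1 : (dnι n g).det = 1 := (g : SL(n + 1, ℝ)).2
    simpa only [Matrix.det_mul, h1, one_mul, dn_cast_det] using this
  have hform : ∀ i j, |((Vᵀ * dnJZ n * V) i j : ℝ)| ≤ E i j := by
    intro i j
    have h := hE i j _ hg
    have hgJ : (dnι n g)ᵀ * Jmat n * dnι n g = Jmat n := g.2
    have : (dnι n g * V.map (Int.cast : ℤ → ℝ))ᵀ * Jmat n * (dnι n g * V.map (Int.cast : ℤ → ℝ))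
        = (Vᵀ * dnJZ n * V).map (Int.cast : ℤ → ℝ) := by
      rw [dn_cast_mul, dn_cast_mul, dn_JZ]
      conv_rhs => rw [← hgJ]
      rw [Matrix.transpose_mul, Matrix.transpose_map]
      simp only [Matrix.mul_assoc]
    rw [this] at h
    exact h
  have hmod : ∀ i j, V i j % V.det ≤ ⌊D⌋ := by
    intro i j
    rw [Int.le_floor]
    refine le_trans ?_ hdet
    exact_mod_cast (Int.emod_lt_abs (V i j) hV0).le
  simp only [Set.mem_Icc, Prod.le_def, Pi.le_def, dnkey]
  refine ⟨⟨fun i j => ?_, ?_, fun i j => Int.emod_nonneg _ hV0⟩, fun i j => ?_, ?_, hmod⟩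
  · exact Int.ceil_le.2 (abs_le.1 (hform i j)).1
  · exact Int.ceil_le.2 (abs_le.1 hdet).1
  · exact Int.le_floor.2 (abs_le.1 (hform i j)).2
  · exact Int.le_floor.2 (abs_le.1 hdet).2

theorem dn_key_eq (n : ℕ) (V V0 : Matrix (Fin (n + 1)) (Fin (n + 1)) ℤ) (h0 : V0.det ≠ 0)
    (h : dnkey n V = dnkey n V0) :
    ∃ γ ∈ SO1nZ n, dnι n γ * V0.map (Int.cast : ℤ → ℝ) = V.map (Int.cast : ℤ → ℝ) := by
  simp only [dnkey, Prod.mk.injEq] at h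
  obtain ⟨hf, hd, hm⟩ := h
  have hf : Vᵀ * dnJZ n * V = V0ᵀ * dnJZ n * V0 := by
    ext i j; exact congrFun (congrFun hf i) j
  have hE : ∀ i j, ∃ c, V i j = V0 i j + V0.det * c := by
    intro i j
    have h1 := congrFun (congrFun hm i) j
    rw [hd] at h1
    obtain ⟨c, hc⟩ := Int.ModEq.dvd (show V0 i j ≡ V i j [ZMOD V0.det] from h1.symm)
    exact ⟨c, by linarith⟩
  choose E hE using hE
  let P : Matrix (Fin (n + 1)) (Fin (n + 1)) ℤ := 1 + Matrix.of E * V0.adjugate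
  have hP : P * V0 = V := by
    simp only [P]
    rw [Matrix.add_mul, Matrix.one_mul, Matrix.mul_assoc, Matrix.adjugate_mul]
    ext i j
    rw [Matrix.mul_smul, Matrix.mul_one, hE i j]
    rfl
  have hPd : P.det = 1 := by
    have := congrArg Matrix.det hP
    rw [Matrix.det_mul, hd] at this
    exact mul_right_cancel₀ h0 (by rw [this, one_mul])
  have hPJ : Pᵀ * dnJZ n * P = dnJZ n := by
    have h1 : V0ᵀ * (Pᵀ * dnJZ n * P) * V0 = V0ᵀ * dnJZ n * V0 := by
      rw [← hf, ← hP, Matrix.transpose_mul]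
      simp only [Matrix.mul_assoc]
    have hr : ∀ A B : Matrix (Fin (n + 1)) (Fin (n + 1)) ℤ, A * V0 = B * V0 → A = B := by
      intro A B hAB
      have := congrArg (· * V0.adjugate) hAB
      simp only [Matrix.mul_assoc, Matrix.mul_adjugate, Matrix.mul_smul, Matrix.mul_one] at this
      exact smul_right_injective _ h0 this
    have hl : ∀ A B : Matrix (Fin (n + 1)) (Fin (n + 1)) ℤ, V0ᵀ * A = V0ᵀ * B → A = B := by
      intro A B hAB
      have := congrArg Matrix.transpose hAB
      simp only [Matrix.transpose_mul, Matrix.transpose_transpose] at this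
      exact Matrix.transpose_injective (hr _ _ this)
    exact hl _ _ (hr _ _ h1)
  let γ0 : SL(n + 1, ℤ) := ⟨P, hPd⟩
  let γ1 : SL(n + 1, ℝ) := Matrix.SpecialLinearGroup.map (Int.castRingHom ℝ) γ0
  have hγ1 : (γ1 : Matrix (Fin (n + 1)) (Fin (n + 1)) ℝ) = P.map (Int.cast : ℤ → ℝ) := rfl
  have hγ2 : γ1 ∈ SO1n n := by
    change (γ1 : Matrix (Fin (n + 1)) (Fin (n + 1)) ℝ)ᵀ * Jmat n * γ1 = Jmat n
    rw [hγ1, ← dn_JZ, ← Matrix.transpose_map, ← dn_cast_mul, ← dn_cast_mul, hPJ]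
  refine ⟨⟨γ1, hγ2⟩, ⟨γ0, rfl⟩, ?_⟩
  change P.map (Int.cast : ℤ → ℝ) * _ = _
  rw [← dn_cast_mul, hP]

theorem dn_compact (n : ℕ) (ε : ℝ) (hε : 0 < ε) : ∃ K : Set (SO1n n), IsCompact K ∧
    ∀ g : SO1n n, (∀ v : Fin (n + 1) → ℤ, v ≠ 0 →
      ∃ i, ε ≤ |(dnι n g *ᵥ (fun j => (v j : ℝ))) i|) → ∃ γ ∈ SO1nZ n, g * γ ∈ K := by
  obtain ⟨C, hC⟩ := dn_reduce (n + 1) ε hε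
  obtain ⟨T, hTs, hT⟩ := Set.exists_subset_bijOn {V : Matrix (Fin (n + 1)) (Fin (n + 1)) ℤ |
    V.det ≠ 0 ∧ ∃ g : SO1n n, dnι n g * V.map (Int.cast : ℤ → ℝ) ∈ dnbox (n + 1) C} (dnkey n)
  have hTf : T.Finite := hT.finite_iff_finite.2 (dn_key_finite n C)
  refine ⟨⋃ V0 ∈ T, dnι n ⁻¹' ((fun X => X * (V0.map (Int.cast : ℤ → ℝ))⁻¹) '' dnbox (n + 1) C),
    hTf.isCompact_biUnion fun V0 _ => (dn_emb n).isCompact_preimage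
      ((dn_box _ _).image (continuous_id.matrix_mul continuous_const)), ?_⟩
  intro g hg
  obtain ⟨V, hV0, hV⟩ := hC (dnι n g) (g : SL(n + 1, ℝ)).2 hg
  obtain ⟨V0, hV0T, hkey⟩ := hT.surjOn ⟨V, ⟨hV0, g, hV⟩, rfl⟩
  have hd0 := (hTs hV0T).1
  obtain ⟨γ, hγ, hγV⟩ := dn_key_eq n V V0 hd0 hkey.symm
  refine ⟨γ, hγ, Set.mem_biUnion hV0T ⟨_, hV, ?_⟩⟩
  have hmul : dnι n (g * γ) = dnι n g * dnι n γ := rfl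
  have hu : IsUnit (V0.map (Int.cast : ℤ → ℝ)).det := by
    rw [dn_cast_det]; exact (Int.cast_ne_zero.2 hd0).isUnit
  simp only [hmul]
  rw [← hγV, ← Matrix.mul_assoc, Matrix.mul_nonsing_inv_cancel_right _ _ hu]

theorem dn_par (n : ℕ) (ε : ℝ) (hε : 0 < ε) (hε1 : (n + 1) * (ε * ε) ≤ 1) (g : SO1n n)
    (v w : Fin (n+1) → ℤ) (hv0 : v ≠ 0)
    (hv : ∀ i, |(dnι n g *ᵥ (fun j => (v j : ℝ))) i| < ε)
    (hw : ∀ i, |(dnι n g *ᵥ (fun j => (w j : ℝ))) i| < ε) :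
    v 0 ≠ 0 ∧ ∀ i, w 0 * v i = v 0 * w i :=
  dn_iso n v w (dn_Bsmall n ε hε hε1 g v v hv hv) (dn_Bsmall n ε hε hε1 g w w hw hw)
    (dn_Bsmall n ε hε hε1 g v w hv hw) hv0

theorem dn_forward (n : ℕ) (b : ℝ → SO1n n) (hb : Continuous b)
    (h : Tendsto (fun t : ℝ => ((b t : SO1n n) : SO1n n ⧸ SO1nZ n))
        atTop (cocompact (SO1n n ⧸ SO1nZ n))) :
    ∃ v : Fin (n + 1) → ℤ, v ≠ 0 ∧
      Tendsto (fun t : ℝ => dnι n (b t) *ᵥ (fun i => (v i : ℝ))) atTop (𝓝 0) := by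
  have key : ∀ ε : ℝ, 0 < ε → ∀ᶠ t in atTop, ∃ v : Fin (n + 1) → ℤ, v ≠ 0 ∧
      ∀ i, |(dnι n (b t) *ᵥ (fun j => (v j : ℝ))) i| < ε := by
    intro ε hε
    obtain ⟨K, hK, hKg⟩ := dn_compact n ε hε
    have hK' : IsCompact ((fun x : SO1n n => (x : SO1n n ⧸ SO1nZ n)) '' K) :=
      hK.image continuous_quotient_mk'
    filter_upwards [h hK'.compl_mem_cocompact] with t ht
    by_contra! hcon
    obtain ⟨γ, hγ, hγK⟩ := hKg (b t) hcon
    apply ht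
    refine ⟨_, hγK, ?_⟩
    exact QuotientGroup.mk_mul_of_mem _ hγ
  obtain ⟨ε, hε, hε1⟩ : ∃ ε : ℝ, 0 < ε ∧ (n + 1) * (ε * ε) ≤ 1 := by
    refine ⟨1 / (n + 1), by positivity, ?_⟩
    have : (0 : ℝ) < n + 1 := by positivity
    field_simp
    linarith
  obtain ⟨T, hT⟩ := eventually_atTop.1 (key ε hε)
  obtain ⟨v, hv0, hv⟩ := hT T le_rfl
  have hv00 := (dn_par n ε hε hε1 (b T) v v hv0 hv hv).1
  have hopen : ∀ w : Fin (n + 1) → ℤ,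
      IsOpen {t | ∀ i, |(dnι n (b t) *ᵥ (fun j => (w j : ℝ))) i| < ε} := by
    intro w
    simp only [Set.setOf_forall]
    refine isOpen_iInter_of_finite fun i => ?_
    refine isOpen_lt ?_ continuous_const
    have h1 : Continuous fun t => dnι n (b t) := (dn_emb n).continuous.comp hb
    exact ((continuous_apply i).comp (h1.matrix_mulVec continuous_const)).abs
  let U : Set ℝ := ⋃ w ∈ {w : Fin (n + 1) → ℤ | w ≠ 0 ∧ ∀ i, w 0 * v i = v 0 * w i},
    {t | ∀ i, |(dnι n (b t) *ᵥ (fun j => (w j : ℝ))) i| < ε}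
  let U' : Set ℝ := ⋃ w ∈ {w : Fin (n + 1) → ℤ | w ≠ 0 ∧ ¬ ∀ i, w 0 * v i = v 0 * w i},
    {t | ∀ i, |(dnι n (b t) *ᵥ (fun j => (w j : ℝ))) i| < ε}
  have hall : ∀ t, T ≤ t → ∀ w : Fin (n + 1) → ℤ, w ≠ 0 →
      (∀ i, |(dnι n (b t) *ᵥ (fun j => (w j : ℝ))) i| < ε) → ∀ i, w 0 * v i = v 0 * w i := by
    intro t ht w hw0 hw
    by_contra hcon
    obtain ⟨t', ht', hU, hU'⟩ := (isPreconnected_Ici (a := T)) U U'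
      (isOpen_biUnion fun w _ => hopen w) (isOpen_biUnion fun w _ => hopen w)
      (by
        intro s hs
        obtain ⟨w, hw0, hw⟩ := hT s hs
        by_cases hp : ∀ i, w 0 * v i = v 0 * w i
        · exact Or.inl (Set.mem_biUnion (x := w) ⟨hw0, hp⟩ hw)
        · exact Or.inr (Set.mem_biUnion (x := w) ⟨hw0, hp⟩ hw))
      ⟨T, Set.self_mem_Ici, Set.mem_biUnion (x := v) ⟨hv0, fun i => rfl⟩ hv⟩
      ⟨t, ht, Set.mem_biUnion (x := w) ⟨hw0, hcon⟩ hw⟩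
    simp only [U, U', Set.mem_iUnion] at hU hU'
    obtain ⟨w1, ⟨hw10, hw1p⟩, hw1⟩ := hU
    obtain ⟨w2, ⟨hw20, hw2p⟩, hw2⟩ := hU'
    apply hw2p
    obtain ⟨h10, h12⟩ := dn_par n ε hε hε1 (b t') w1 w2 hw10 hw1 hw2
    intro i
    apply mul_left_cancel₀ h10
    calc w1 0 * (w2 0 * v i) = w2 0 * (w1 0 * v i) := by ring
      _ = v 0 * (w2 0 * w1 i) := by rw [hw1p i]; ring
      _ = w1 0 * (v 0 * w2 i) := by rw [h12 i]; ring
  refine ⟨v, hv0, ?_⟩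
  rw [tendsto_pi_nhds]
  intro i
  rw [Metric.tendsto_nhds]
  intro η hη
  have hvpos : (0 : ℝ) < |(v 0 : ℝ)| := abs_pos.2 (Int.cast_ne_zero.2 hv00)
  filter_upwards [key (min ε (η / |(v 0 : ℝ)|)) (lt_min hε (by positivity)), eventually_ge_atTop T]
    with t ⟨w, hw0, hw⟩ ht
  have hwε : ∀ i, |(dnι n (b t) *ᵥ (fun j => (w j : ℝ))) i| < ε :=
    fun i => (hw i).trans_le (min_le_left _ _)
  have hw00 := (dn_par n ε hε hε1 (b t) w w hw0 hwε hwε).1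
  have hp := hall t ht w hw0 hwε
  have hvec : (w 0 : ℝ) • (fun j => (v j : ℝ)) = (v 0 : ℝ) • (fun j => (w j : ℝ)) := by
    ext j
    simp only [Pi.smul_apply, smul_eq_mul]
    exact_mod_cast hp j
  have h1 := congrArg (fun x => (dnι n (b t) *ᵥ x) i) hvec
  simp only [Matrix.mulVec_smul, Pi.smul_apply, smul_eq_mul] at h1
  have h2 := (hw i).trans_le (min_le_right _ _)
  rw [lt_div_iff₀ hvpos] at h2
  have h3 : (1 : ℝ) ≤ |(w 0 : ℝ)| := by exact_mod_cast Int.one_le_abs hw00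
  have h4 := congrArg abs h1
  rw [abs_mul, abs_mul] at h4
  simp only [Pi.zero_apply, dist_zero_right, Real.norm_eq_abs]
  nlinarith [abs_nonneg ((dnι n (b t) *ᵥ (fun j => (v j : ℝ))) i)]

theorem dn_backward (n : ℕ) (b : ℝ → SO1n n) (ℓ : ℕ) (ρ : SO1n n →* SL(ℓ, ℝ))
    (v : Fin ℓ → ℤ) (hρ : Continuous ρ) (hρΓ : ∀ γ ∈ SO1nZ n, ρ γ ∈ SLZ ℓ) (hv : v ≠ 0)
    (h : Tendsto (fun t : ℝ => (ρ (b t) : Matrix (Fin ℓ) (Fin ℓ) ℝ) *ᵥ (fun i => (v i : ℝ)))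
      atTop (𝓝 0)) :
    Tendsto (fun t : ℝ => ((b t : SO1n n) : SO1n n ⧸ SO1nZ n))
        atTop (cocompact (SO1n n ⧸ SO1nZ n)) := by
  let F : SO1n n → Matrix (Fin ℓ) (Fin ℓ) ℝ :=
    fun x => (ρ x : Matrix (Fin ℓ) (Fin ℓ) ℝ).adjugate
  have hF : Continuous F := (continuous_subtype_val.comp hρ).matrix_adjugate
  let U : ℕ → Set (SO1n n) := fun k => {x | ∀ i j, |F x i j| < k}
  have hU : ∀ k, IsOpen (U k) := by
    intro k
    simp only [U, Set.setOf_forall]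
    exact isOpen_iInter_of_finite fun i => isOpen_iInter_of_finite fun j =>
      isOpen_lt (hF.matrix_elem i j).abs continuous_const
  have hUmono : Monotone U := by
    intro k l hkl x hx i j
    exact (hx i j).trans_le (by exact_mod_cast hkl)
  have hUcov : ∀ x, ∃ k, x ∈ U k := by
    intro x
    obtain ⟨k, hk⟩ := exists_nat_gt (∑ i, ∑ j, |F x i j|)
    refine ⟨k, fun i j => lt_of_le_of_lt ?_ hk⟩
    calc |F x i j| ≤ ∑ j, |F x i j| :=
          Finset.single_le_sum (f := fun j => |F x i j|) (fun _ _ => abs_nonneg _)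
            (Finset.mem_univ j)
      _ ≤ _ := Finset.single_le_sum (f := fun i => ∑ j, |F x i j|)
          (fun _ _ => Finset.sum_nonneg fun _ _ => abs_nonneg _) (Finset.mem_univ i)
  have hopen : IsOpenMap (fun x : SO1n n => (x : SO1n n ⧸ SO1nZ n)) := by
    have hc : ∀ γ : SO1n n, Continuous fun x : SO1n n => x * γ := by
      intro γ
      rw [(dn_emb n).isInducing.continuous_iff]
      exact (dn_emb n).continuous.matrix_mul continuous_const
    intro O hO
    have : IsOpen ((fun x : SO1n n => (x : SO1n n ⧸ SO1nZ n)) ⁻¹'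
        ((fun x : SO1n n => (x : SO1n n ⧸ SO1nZ n)) '' O)) := by
      have heq : ((fun x : SO1n n => (x : SO1n n ⧸ SO1nZ n)) ⁻¹'
        ((fun x : SO1n n => (x : SO1n n ⧸ SO1nZ n)) '' O)) =
          ⋃ γ ∈ SO1nZ n, (fun x : SO1n n => x * γ) ⁻¹' O := by
        ext x
        simp only [Set.mem_preimage, Set.mem_image, Set.mem_iUnion, exists_prop]
        constructor
        · rintro ⟨y, hy, hyx⟩
          refine ⟨x⁻¹ * y, QuotientGroup.eq.1 hyx.symm, by simpa using hy⟩
        · rintro ⟨γ, hγ, hx⟩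
          exact ⟨_, hx, QuotientGroup.mk_mul_of_mem _ hγ⟩
      rw [heq]
      exact isOpen_biUnion fun γ _ => hO.preimage (hc γ)
    exact isQuotientMap_quotient_mk'.isOpen_preimage.1 this
  rw [(hasBasis_cocompact).tendsto_right_iff]
  intro K hK
  obtain ⟨k, hk⟩ : ∃ k, K ⊆ (fun x : SO1n n => (x : SO1n n ⧸ SO1nZ n)) '' U k := by
    refine hK.elim_directed_cover _ (fun k => hopen _ (hU k)) ?_ ?_
    · intro x _
      obtain ⟨y, rfl⟩ := QuotientGroup.mk_surjective x
      obtain ⟨k, hk⟩ := hUcov y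
      exact Set.mem_iUnion.2 ⟨k, y, hk, rfl⟩
    · exact Monotone.directed_le fun k l hkl => Set.image_mono (hUmono hkl)
  have hη : (0 : ℝ) < 1 / (ℓ * k + 1) := by positivity
  have hsm : ∀ᶠ t in atTop, ∀ i,
      |((ρ (b t) : Matrix (Fin ℓ) (Fin ℓ) ℝ) *ᵥ (fun i => (v i : ℝ))) i| < 1 / (ℓ * k + 1) := by
    rw [eventually_all]
    intro i
    have := (tendsto_pi_nhds.1 h) i
    have := (Metric.tendsto_nhds.1 this) _ hη
    simpa using this
  filter_upwards [hsm] with t ht hmem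
  obtain ⟨u, hu, hut⟩ := hk hmem
  have hγ : u⁻¹ * b t ∈ SO1nZ n := QuotientGroup.eq.1 hut
  obtain ⟨P, hP⟩ := hρΓ _ hγ
  have hPm : ((P : Matrix (Fin ℓ) (Fin ℓ) ℤ).map (Int.cast : ℤ → ℝ)) = F u * ρ (b t) := by
    have h1 := congrArg (fun x : SL(ℓ, ℝ) => (x : Matrix (Fin ℓ) (Fin ℓ) ℝ)) hP
    simp only [map_mul, map_inv, Matrix.SpecialLinearGroup.coe_mul,
      Matrix.SpecialLinearGroup.coe_inv] at h1
    exact h1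
  set y := (ρ (b t) : Matrix (Fin ℓ) (Fin ℓ) ℝ) *ᵥ (fun i => (v i : ℝ)) with hy
  have hz : (P : Matrix (Fin ℓ) (Fin ℓ) ℤ) *ᵥ v = 0 := by
    ext i
    have h1 : ((((P : Matrix (Fin ℓ) (Fin ℓ) ℤ) *ᵥ v) i : ℤ) : ℝ) = (F u *ᵥ y) i := by
      rw [hy, Matrix.mulVec_mulVec, ← hPm]
      simp [Matrix.mulVec, dotProduct]
    have h2 : |(F u *ᵥ y) i| < 1 := by
      calc |(F u *ᵥ y) i| = |∑ j, F u i j * y j| := rfl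
        _ ≤ ∑ j, |F u i j * y j| := Finset.abs_sum_le_sum_abs _ _
        _ ≤ ∑ j : Fin ℓ, (k : ℝ) * (1 / (ℓ * k + 1)) := Finset.sum_le_sum fun j _ => by
          rw [abs_mul]
          exact mul_le_mul (hu i j).le (ht j).le (abs_nonneg _) (by positivity)
        _ = (ℓ * k) / (ℓ * k + 1) := by simp; ring
        _ < 1 := by
          rw [div_lt_one (by positivity)]; linarith
    rw [← h1] at h2
    rw [Pi.zero_apply, ← Int.abs_lt_one_iff]
    exact_mod_cast h2
  apply hv
  exact Matrix.eq_zero_of_mulVec_eq_zero (by rw [P.2]; exact one_ne_zero) hz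

/-- **Dani**: in ℚ-rank one (here `G = SO(1,n)`, `Γ = G ∩ SL(n+1,ℤ)`), an orbit of an
ℝ-diagonalizable one-parameter subgroup `a(t)` diverges to infinity in `G/Γ` if and
only if there is a rational representation `ρ` of `G` and a nonzero integer vector `v`
with `ρ(a(t)g)v → 0`. -/
theorem dani_divergent_orbits_rank_one (n : ℕ) (hn : 2 ≤ n)
    (a : ℝ → SO1n n)
    (ha_hom : ∀ s t : ℝ, a (s + t) = a s * a t) (ha_cont : Continuous a)
    (ha_diag : ∀ t : ℝ, ∃ (P : GL (Fin (n + 1)) ℝ) (d : Fin (n + 1) → ℝ),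
      ((a t : SL(n + 1, ℝ)) : Matrix (Fin (n + 1)) (Fin (n + 1)) ℝ) =
        (P : Matrix (Fin (n + 1)) (Fin (n + 1)) ℝ) * Matrix.diagonal d *
          ((P⁻¹ : GL (Fin (n + 1)) ℝ) : Matrix (Fin (n + 1)) (Fin (n + 1)) ℝ))
    (g : SO1n n) :
    Tendsto (fun t : ℝ => ((a t * g : SO1n n) : SO1n n ⧸ SO1nZ n))
        atTop (cocompact (SO1n n ⧸ SO1nZ n)) ↔
      ∃ (ℓ : ℕ) (ρ : SO1n n →* SL(ℓ, ℝ)) (v : Fin ℓ → ℤ),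
        1 ≤ ℓ ∧ Continuous ρ ∧ (∀ γ ∈ SO1nZ n, ρ γ ∈ SLZ ℓ) ∧ v ≠ 0 ∧
        Tendsto
          (fun t : ℝ =>
            (ρ (a t * g) : Matrix (Fin ℓ) (Fin ℓ) ℝ) *ᵥ (fun i => (v i : ℝ)))
          atTop (𝓝 0) := by
  constructor
  · intro h
    have hc : Continuous fun t => a t * g := by
      rw [(dn_emb n).isInducing.continuous_iff]
      exact ((dn_emb n).continuous.comp ha_cont).matrix_mul continuous_const
    obtain ⟨v, hv0, hv⟩ := dn_forward n (fun t => a t * g) hc h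
    exact ⟨n + 1, (SO1n n).subtype, v, by omega, continuous_subtype_val, fun γ hγ => hγ, hv0, hv⟩
  · rintro ⟨ℓ, ρ, v, _, hρ, hρΓ, hv, h⟩
    exact dn_backward n (fun t => a t * g) ℓ ρ v hρ hρΓ hv h
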